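/- Let γ ∈ (−3,−2), let κ ∈ (0,1/2), and set m(v) = exp(κ⟨v⟩²). Then limsup_{|v|→∞} ζ_m(v) ⟨v⟩^{−2−γ} ≤ 4κ(4κ−1) and limsup_{|v|→∞} ζ̃_m(v) ⟨v⟩^{−2−γ} ≤ 4κ(2κ−1). -/

import Mathlib

noncomputable section

open MeasureTheory Real Filter

abbrev V3 := EuclideanSpace ℝ (Fin 3)

/-- Japanese bracket ⟨v⟩ = (1+|v|²)^{1/2}. -/
def jap (v : V3) : ℝ := Real.sqrt (1 + ‖v‖ ^ 2)

/-- Standard Gaussian μ on ℝ³. -/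
def gaussM (v : V3) : ℝ := (2 * Real.pi) ^ (-(3 : ℝ) / 2) * Real.exp (-‖v‖ ^ 2 / 2)

/-- Landau kernel matrix a_{ij}(z). -/
def aker (γ : ℝ) (z : V3) (i j : Fin 3) : ℝ :=
  ‖z‖ ^ (γ + 2) * ((if i = j then (1 : ℝ) else 0) - z i * z j / ‖z‖ ^ 2)

/-- ā_{ij} = a_{ij} * μ. -/
def abar (γ : ℝ) (v : V3) (i j : Fin 3) : ℝ := ∫ w : V3, aker γ (v - w) i j * gaussM w

def bker (γ : ℝ) (z : V3) (i : Fin 3) : ℝ := -2 * ‖z‖ ^ γ * z i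

/-- b̄_i = b_i * μ. -/
def bbar (γ : ℝ) (v : V3) (i : Fin 3) : ℝ := ∫ w : V3, bker γ (v - w) i * gaussM w

/-- J_β(v) = ∫ |v−w|^β μ(w) dw. -/
def Jfun (β : ℝ) (v : V3) : ℝ := ∫ w : V3, ‖v - w‖ ^ β * gaussM w

/-- c̄(v) = −2(γ+3) J_γ(v). -/
def cbar (γ : ℝ) (v : V3) : ℝ := -2 * (γ + 3) * Jfun γ v

/-- ℓ₁(v). -/
def ell1 (γ : ℝ) (v : V3) : ℝ :=
  ∫ w : V3, (1 - ((∑ i, v i * w i) / (‖v‖ * ‖w‖)) ^ 2) * ‖w‖ ^ (γ + 2) * gaussM (v - w)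

/-- Squared Euclidean norm of the cross product of two vectors in ℝ³. -/
def crossSq (a b : V3) : ℝ :=
  ∑ i, (crossProduct (R := ℝ) (fun k => a k) (fun k => b k) i) ^ 2

/-- ℓ₂(v). -/
def ell2 (γ : ℝ) (v : V3) : ℝ :=
  ∫ w : V3,
    (1 - (1 / 2) * crossSq (‖v‖⁻¹ • v) (‖w‖⁻¹ • w)) * ‖w‖ ^ (γ + 2) * gaussM (v - w)

/-- Projection P_v ξ on the direction v. -/
def Pv (v ξ : V3) : V3 := ((∑ i, ξ i * v i) / ‖v‖ ^ 2) • v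

/-- Partial derivative in the i-th coordinate direction. -/
def pd (i : Fin 3) (f : V3 → ℝ) : V3 → ℝ := fun v => fderiv ℝ f v (EuclideanSpace.single i 1)

/-- Anisotropic gradient ∇̃f = P_v ∇f + ⟨v⟩ (I − P_v) ∇f. -/
def anisoGrad (f : V3 → ℝ) (v : V3) : V3 :=
  Pv v (gradient f v) + jap v • (gradient f v - Pv v (gradient f v))

/-- The filter |v| → ∞ on ℝ³. -/
def normAtTop : Filter V3 := Filter.comap (fun v : V3 => ‖v‖) Filter.atTop

/-- ζ_m(v) = Σ ā_{ij} ∂_{ij}m/m + Σ ā_{ij} (∂_i m/m)(∂_j m/m) + 2 Σ b̄_i ∂_i m/m − c̄/2. -/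
def zeta (γ : ℝ) (m : V3 → ℝ) (v : V3) : ℝ :=
  (∑ i, ∑ j, abar γ v i j * pd i (pd j m) v / m v)
  + (∑ i, ∑ j, abar γ v i j * (pd i m v / m v) * (pd j m v / m v))
  + 2 * (∑ i, bbar γ v i * pd i m v / m v)
  - cbar γ v / 2

/-- ζ̃_m(v) = Σ ā_{ij} (∂_i m/m)(∂_j m/m) + Σ b̄_i ∂_i m/m − c̄/2. -/
def zetaT (γ : ℝ) (m : V3 → ℝ) (v : V3) : ℝ :=
  (∑ i, ∑ j, abar γ v i j * (pd i m v / m v) * (pd j m v / m v))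
  + (∑ i, bbar γ v i * pd i m v / m v)
  - cbar γ v / 2

/-- ζ_{m,ω}(v). -/
def zetaMW (γ : ℝ) (m ω : V3 → ℝ) (v : V3) : ℝ :=
  (∑ i, ∑ j, abar γ v i j * pd i (pd j ω) v / ω v)
  + (∑ i, ∑ j, abar γ v i j * (pd i ω v / ω v) * (pd j ω v / ω v))
  - 2 * (∑ i, ∑ j, abar γ v i j * (pd i ω v / ω v) * (pd j m v / m v))

/-- A cubic polynomial in `‖w‖²` times the Gaussian is dominated by a wider Gaussian. -/
lemma one_add_normSq_pow_three_mul_gaussM_le (w : V3) :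
    (1 + ‖w‖ ^ 2) ^ 3 * gaussM w ≤
      384 * exp (1 / 4) * (2 * π) ^ (-(3 : ℝ) / 2) * exp (-(1 / 4) * ‖w‖ ^ 2) := by
  have h := Real.pow_div_factorial_le_exp ((1 + ‖w‖ ^ 2) / 4) (by positivity) 3
  have h' : (1 + ‖w‖ ^ 2) ^ 3 ≤ 384 * exp ((1 + ‖w‖ ^ 2) / 4) := by
    norm_num [Nat.factorial] at h
    linarith
  unfold gaussM
  calc (1 + ‖w‖ ^ 2) ^ 3 * ((2 * π) ^ (-(3 : ℝ) / 2) * exp (-‖w‖ ^ 2 / 2))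
      ≤ 384 * exp ((1 + ‖w‖ ^ 2) / 4) * ((2 * π) ^ (-(3 : ℝ) / 2) * exp (-‖w‖ ^ 2 / 2)) := by
        gcongr
    _ = 384 * (2 * π) ^ (-(3 : ℝ) / 2) * (exp ((1 + ‖w‖ ^ 2) / 4) * exp (-‖w‖ ^ 2 / 2)) := by ring
    _ = 384 * (2 * π) ^ (-(3 : ℝ) / 2) * (exp (1 / 4) * exp (-(1 / 4) * ‖w‖ ^ 2)) := by
        rw [← exp_add, ← exp_add]; ring_nf
    _ = _ := by ring

lemma gaussM_nonneg (w : V3) : 0 ≤ gaussM w := by unfold gaussM; positivity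

lemma continuous_gaussM : Continuous gaussM := by unfold gaussM; fun_prop

lemma integrable_exp_neg_mul_normSq {b : ℝ} (hb : 0 < b) :
    Integrable fun w : V3 => exp (-b * ‖w‖ ^ 2) := by
  have h := (GaussianFourier.integrable_cexp_neg_mul_sq_norm_add (V := V3) (b := (b : ℂ))
    (by simpa using hb) 0 0).norm
  refine h.congr (ae_of_all _ fun w => ?_)
  simp only [Complex.norm_exp]
  congr 1
  simp [← Complex.ofReal_pow]

lemma integrable_pow_three_mul_gaussM :
    Integrable fun w : V3 => (1 + ‖w‖ ^ 2) ^ 3 * gaussM w := by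
  refine ((integrable_exp_neg_mul_normSq (b := 1 / 4) (by norm_num)).const_mul
    (384 * exp (1 / 4) * (2 * π) ^ (-(3 : ℝ) / 2))).mono' ?_ (ae_of_all _ fun w => ?_)
  · have := continuous_gaussM
    exact (by fun_prop : Continuous fun w : V3 => (1 + ‖w‖ ^ 2) ^ 3 * gaussM w).aestronglyMeasurable
  · rw [norm_of_nonneg (mul_nonneg (by positivity) (gaussM_nonneg w))]
    exact one_add_normSq_pow_three_mul_gaussM_le w

lemma integrable_mul_gaussM {g : V3 → ℝ} (hg : Continuous g) {C : ℝ}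
    (hC : ∀ w, |g w| ≤ C * (1 + ‖w‖ ^ 2)) : Integrable fun w => g w * gaussM w := by
  refine (integrable_pow_three_mul_gaussM.const_mul C).mono'
    (hg.mul continuous_gaussM).aestronglyMeasurable (ae_of_all _ fun w => ?_)
  have hC0 : 0 ≤ C := by
    have := (abs_nonneg _).trans (hC 0)
    simpa using this
  rw [norm_mul, norm_of_nonneg (gaussM_nonneg w), norm_eq_abs, ← mul_assoc]
  refine mul_le_mul_of_nonneg_right ((hC w).trans ?_) (gaussM_nonneg w)
  gcongr
  exact le_self_pow₀ (by nlinarith [sq_nonneg ‖w‖]) (by norm_num)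

lemma tendsto_pow_three_mul_gaussM :
    Tendsto (fun w : V3 => (1 + ‖w‖ ^ 2) ^ 3 * gaussM w) normAtTop (nhds 0) := by
  have h1 : Tendsto (fun w : V3 => -(1 / 4) * ‖w‖ ^ 2) normAtTop atBot :=
    ((tendsto_pow_atTop two_ne_zero).comp tendsto_comap).const_mul_atTop_of_neg (by norm_num)
  have h2 := (tendsto_exp_atBot.comp h1).const_mul
    (384 * exp (1 / 4) * (2 * π) ^ (-(3 : ℝ) / 2))
  rw [mul_zero] at h2
  exact squeeze_zero (fun w => mul_nonneg (by positivity) (gaussM_nonneg w))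
    one_add_normSq_pow_three_mul_gaussM_le h2

lemma gaussM_eq_prod (w : V3) : gaussM w = ∏ i, ProbabilityTheory.gaussianPDFReal 0 1 (w i) := by
  simp only [ProbabilityTheory.gaussianPDFReal, Fin.prod_univ_three, gaussM,
    EuclideanSpace.norm_sq_eq, Fin.sum_univ_three]
  have h : (2 * π) ^ (-(3 : ℝ) / 2) = (√(2 * π))⁻¹ ^ 3 := by
    rw [sqrt_eq_rpow, ← rpow_neg (by positivity), ← rpow_natCast, ← rpow_mul (by positivity)]
    norm_num
  have he : exp (-(‖w 0‖ ^ 2 + ‖w 1‖ ^ 2 + ‖w 2‖ ^ 2) / 2) =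
      exp (-(w 0) ^ 2 / 2) * exp (-(w 1) ^ 2 / 2) * exp (-(w 2) ^ 2 / 2) := by
    rw [← exp_add, ← exp_add]
    simp only [norm_eq_abs, sq_abs]
    ring_nf
  rw [h, he]
  simp
  ring

lemma integral_prod_pow_mul_gaussM (e : Fin 3 → ℕ) :
    ∫ w : V3, (∏ i, w i ^ e i) * gaussM w =
      ∏ i, ∫ x, x ^ e i ∂(ProbabilityTheory.gaussianReal 0 1) := by
  simp_rw [ProbabilityTheory.integral_gaussianReal_eq_integral_smul one_ne_zero]
  rw [← integral_fintype_prod_volume_eq_prod,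
    ← (PiLp.volume_preserving_toLp (Fin 3)).integral_comp
      (MeasurableEquiv.toLp 2 _).measurableEmbedding]
  refine integral_congr_ae (ae_of_all _ fun x => ?_)
  simp only [gaussM_eq_prod, smul_eq_mul, Finset.prod_mul_distrib]
  ring

lemma integral_sq_gaussianReal : ∫ x, x ^ 2 ∂(ProbabilityTheory.gaussianReal 0 1) = 1 := by
  have h := ProbabilityTheory.variance_id_gaussianReal (μ := 0) (v := 1)
  rw [ProbabilityTheory.variance_of_integral_eq_zero measurable_id.aemeasurable
    (by simp)] at h
  simpa using h

lemma integral_gaussM : ∫ w : V3, gaussM w = 1 := by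
  simpa using integral_prod_pow_mul_gaussM 0

lemma integral_coord_mul_gaussM (i : Fin 3) : ∫ w : V3, w i * gaussM w = 0 := by
  have h := integral_prod_pow_mul_gaussM (Pi.single i 1)
  fin_cases i <;> simpa [Fin.prod_univ_three, Pi.single_apply] using h

lemma integral_coord_mul_coord_mul_gaussM (i j : Fin 3) :
    ∫ w : V3, w i * w j * gaussM w = if i = j then 1 else 0 := by
  have h := integral_prod_pow_mul_gaussM (Pi.single i 1 + Pi.single j 1)
  have e (w : V3) :
      ∏ k, w k ^ (Pi.single i 1 + Pi.single j 1 : Fin 3 → ℕ) k = w i * w j := by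
    simp only [Pi.add_apply, pow_add, Finset.prod_mul_distrib]
    simp [Pi.single_apply, pow_ite]
  simp_rw [e] at h
  rw [h]
  fin_cases i <;> fin_cases j <;>
    simp [Fin.prod_univ_three, Pi.single_apply, integral_sq_gaussianReal]

lemma abs_coord_le (w : V3) (i : Fin 3) : |w i| ≤ ‖w‖ := PiLp.norm_apply_le w i

lemma integral_quadratic_mul_gaussM (c : ℝ) (l : Fin 3 → ℝ) (q : Fin 3 → Fin 3 → ℝ) :
    ∫ w : V3, (c + ∑ i, l i * w i + ∑ i, ∑ j, q i j * (w i * w j)) * gaussM w =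
      c + ∑ i, q i i := by
  have h0 : Integrable fun w : V3 => gaussM w := by
    simpa using integrable_mul_gaussM (g := fun _ => 1) continuous_const (C := 1)
      (fun w => by simp)
  have h1 (i : Fin 3) : Integrable fun w : V3 => w i * gaussM w :=
    integrable_mul_gaussM (by fun_prop) (C := 1) fun w => by
      nlinarith [abs_coord_le w i, sq_nonneg (‖w‖ - 1)]
  have h2 (i j : Fin 3) : Integrable fun w : V3 => w i * w j * gaussM w :=
    integrable_mul_gaussM (by fun_prop) (C := 1) fun w => by
      rw [abs_mul]
      nlinarith [mul_le_mul (abs_coord_le w i) (abs_coord_le w j) (abs_nonneg _) (norm_nonneg _)]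
  have h1' : Integrable fun w : V3 => ∑ i, l i * (w i * gaussM w) :=
    integrable_finsetSum _ fun i _ => (h1 i).const_mul _
  have h2' (i : Fin 3) : Integrable fun w : V3 => ∑ j, q i j * (w i * w j * gaussM w) :=
    integrable_finsetSum _ fun j _ => (h2 i j).const_mul _
  have e : (fun w : V3 => (c + ∑ i, l i * w i + ∑ i, ∑ j, q i j * (w i * w j)) * gaussM w) =
      fun w => c * gaussM w + ∑ i, l i * (w i * gaussM w) +
        ∑ i, ∑ j, q i j * (w i * w j * gaussM w) := by
    ext w
    simp only [add_mul, Finset.sum_mul, mul_assoc]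
  have h01 : Integrable fun w : V3 => c * gaussM w + ∑ i, l i * (w i * gaussM w) :=
    (h0.const_mul c).add h1'
  rw [e, integral_add h01 (integrable_finsetSum _ fun i _ => h2' i),
    integral_add (h0.const_mul c) h1', integral_finsetSum _ fun i _ => (h1 i).const_mul _,
    integral_finsetSum _ fun i _ => h2' i]
  simp_rw [integral_finsetSum _ fun j _ => (h2 _ j).const_mul _, integral_const_mul,
    integral_gaussM, integral_coord_mul_gaussM, integral_coord_mul_coord_mul_gaussM]
  simp

lemma jap_sq (v : V3) : jap v ^ 2 = 1 + ‖v‖ ^ 2 := sq_sqrt (by positivity)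

lemma one_le_jap (v : V3) : 1 ≤ jap v := by
  rw [jap, one_le_sqrt]; nlinarith [sq_nonneg ‖v‖]

lemma jap_pos (v : V3) : 0 < jap v := one_pos.trans_le (one_le_jap v)

lemma norm_le_jap (v : V3) : ‖v‖ ≤ jap v := le_sqrt_of_sq_le (by linarith)

lemma jap_le_norm_add_one (v : V3) : jap v ≤ ‖v‖ + 1 :=
  sqrt_le_iff.2 ⟨by positivity, by nlinarith [norm_nonneg v]⟩

lemma tendsto_jap : Tendsto jap normAtTop atTop :=
  tendsto_atTop_mono norm_le_jap tendsto_comap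

/-- The normalised kernel `⟨v⟩^{-γ} |v - w|^γ`, which tends to `1` as `|v| → ∞`. -/
def normKer (γ : ℝ) (v w : V3) : ℝ := jap v ^ (-γ) * ‖v - w‖ ^ γ

/-- The singular part of `|u|^γ`. -/
def singKer (γ : ℝ) (u : V3) : ℝ := if ‖u‖ < 1 then ‖u‖ ^ γ else 0

lemma normKer_nonneg (γ : ℝ) (v w : V3) : 0 ≤ normKer γ v w := by
  have := (jap_pos v).le
  unfold normKer; positivity

lemma singKer_nonneg (γ : ℝ) (u : V3) : 0 ≤ singKer γ u := by
  unfold singKer; split_ifs <;> positivity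

lemma measurable_normKer (γ : ℝ) (v : V3) : Measurable (normKer γ v) := by
  unfold normKer; fun_prop

lemma measurable_singKer (γ : ℝ) : Measurable (singKer γ) :=
  Measurable.ite (measurableSet_lt measurable_norm measurable_const) (by fun_prop) measurable_const

lemma integrable_singKer {γ : ℝ} (hγ : -3 < γ) : Integrable (singKer γ) := by
  have h : IntegrableOn (fun u : V3 => ‖u‖ ^ γ) (Metric.ball 0 1) :=
    integrableOn_ball_of_norm_le_rpow (C := 1) (α := -γ) (by simp) (by simp; linarith)
      (ae_of_all _ fun u => by
        rw [neg_neg, one_mul, norm_of_nonneg (by positivity)])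
      (by fun_prop : Measurable fun u : V3 => ‖u‖ ^ γ).aestronglyMeasurable
  rw [← integrable_indicator_iff measurableSet_ball] at h
  refine h.congr (ae_of_all _ fun u => ?_)
  simp only [singKer, Set.indicator, mem_ball_zero_iff]

lemma jap_rpow_le {γ : ℝ} (hγ : γ ∈ Set.Ioo (-3 : ℝ) (-2)) {v w : V3} {r : ℝ} (hr : 1 ≤ r)
    (hvw : ‖v - w‖ ≤ r) : (jap v / r) ^ (-γ) ≤ 16 * (1 + ‖w‖ ^ 2) ^ 2 := by
  have hr0 : 0 < r := by linarith
  have hv : ‖v‖ ≤ ‖w‖ + r := by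
    have := norm_le_norm_add_norm_sub w v
    rw [norm_sub_rev] at this
    linarith
  have h1 : jap v / r ≤ 2 * jap w := by
    rw [div_le_iff₀ hr0]
    refine abs_le_of_sq_le_sq' ?_ (by have := jap_pos w; positivity) |>.2
    rw [mul_pow, mul_pow, jap_sq, jap_sq]
    have : ‖v‖ ^ 2 ≤ (‖w‖ + r) ^ 2 := by gcongr
    have hr2 : 1 ≤ r ^ 2 := one_le_pow₀ hr
    nlinarith [mul_nonneg (sq_nonneg ‖w‖) (sub_nonneg.2 hr2), sq_nonneg (‖w‖ - r)]
  have h2 : 1 ≤ 2 * jap w := by linarith [one_le_jap w]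
  calc (jap v / r) ^ (-γ) ≤ (2 * jap w) ^ (-γ) :=
        rpow_le_rpow (div_nonneg (jap_pos v).le hr0.le) h1 (by linarith [hγ.2])
    _ ≤ (2 * jap w) ^ (4 : ℝ) := rpow_le_rpow_of_exponent_le h2 (by linarith [hγ.1])
    _ = 16 * (jap w ^ 2) ^ 2 := by norm_cast; ring
    _ = _ := by rw [jap_sq]

lemma normKer_le_of_one_le {γ : ℝ} (hγ : γ ∈ Set.Ioo (-3 : ℝ) (-2)) {v w : V3}
    (h : 1 ≤ ‖v - w‖) : normKer γ v w ≤ 16 * (1 + ‖w‖ ^ 2) ^ 2 := by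
  have := jap_rpow_le hγ h le_rfl
  rwa [div_rpow (jap_pos v).le (norm_nonneg _), rpow_neg (norm_nonneg _), div_inv_eq_mul] at this

lemma normKer_le_of_lt_one {γ : ℝ} (hγ : γ ∈ Set.Ioo (-3 : ℝ) (-2)) {v w : V3}
    (h : ‖v - w‖ < 1) : normKer γ v w ≤ singKer γ (v - w) * (16 * (1 + ‖w‖ ^ 2) ^ 2) := by
  have := jap_rpow_le hγ le_rfl h.le
  rw [div_one] at this
  rw [normKer, singKer, if_pos h, mul_comm]
  gcongr

lemma pow_three_mul_gaussM_nonneg (w : V3) : 0 ≤ (1 + ‖w‖ ^ 2) ^ 3 * gaussM w :=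
  mul_nonneg (by positivity) (gaussM_nonneg w)

lemma exists_bound_pow_three_mul_gaussM : ∃ M, ∀ w : V3, (1 + ‖w‖ ^ 2) ^ 3 * gaussM w ≤ M := by
  refine ⟨384 * exp (1 / 4) * (2 * π) ^ (-(3 : ℝ) / 2), fun w =>
    (one_add_normSq_pow_three_mul_gaussM_le w).trans (mul_le_of_le_one_right (by positivity) ?_)⟩
  rw [exp_le_one_iff]
  nlinarith [sq_nonneg ‖w‖]

lemma continuous_pow_three_mul_gaussM :
    Continuous fun w : V3 => (1 + ‖w‖ ^ 2) ^ 3 * gaussM w := by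
  have := continuous_gaussM
  fun_prop

lemma integrable_singKer_mul_shift {γ : ℝ} (hγ : -3 < γ) (v : V3) :
    Integrable fun u => singKer γ u * ((1 + ‖v - u‖ ^ 2) ^ 3 * gaussM (v - u)) := by
  obtain ⟨M, hM⟩ := exists_bound_pow_three_mul_gaussM
  refine (integrable_singKer hγ).mul_bdd (c := M)
    (continuous_pow_three_mul_gaussM.comp (continuous_const.sub continuous_id)).aestronglyMeasurable
    (ae_of_all _ fun u => ?_)
  rw [norm_of_nonneg (pow_three_mul_gaussM_nonneg _)]
  exact hM _

lemma integrable_singKer_sub_mul {γ : ℝ} (hγ : -3 < γ) (v : V3) :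
    Integrable fun w => singKer γ (v - w) * ((1 + ‖w‖ ^ 2) ^ 3 * gaussM w) := by
  simpa using (integrable_singKer_mul_shift hγ v).comp_sub_left v

lemma tendsto_sub_const_normAtTop (u : V3) : Tendsto (fun v => v - u) normAtTop normAtTop := by
  refine tendsto_comap_iff.2 (tendsto_atTop_mono (fun v => ?_)
    (tendsto_atTop_add_const_right normAtTop (-‖u‖) tendsto_comap))
  simpa [sub_eq_add_neg] using norm_sub_norm_le v u

instance : normAtTop.IsCountablyGenerated := by unfold normAtTop; infer_instance

instance : normAtTop.NeBot := by
  rw [normAtTop, comap_norm_atTop]; infer_instance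

lemma tendsto_integral_singKer {γ : ℝ} (hγ : -3 < γ) :
    Tendsto (fun v => ∫ w, singKer γ (v - w) * ((1 + ‖w‖ ^ 2) ^ 3 * gaussM w))
      normAtTop (nhds 0) := by
  obtain ⟨M, hM⟩ := exists_bound_pow_three_mul_gaussM
  have e (v : V3) : ∫ w, singKer γ (v - w) * ((1 + ‖w‖ ^ 2) ^ 3 * gaussM w) =
      ∫ u, singKer γ u * ((1 + ‖v - u‖ ^ 2) ^ 3 * gaussM (v - u)) := by
    rw [← integral_sub_left_eq_self _ volume v]
    simp
  simp_rw [e]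
  rw [← integral_zero V3 ℝ]
  refine tendsto_integral_filter_of_dominated_convergence (fun u => singKer γ u * M)
    (Eventually.of_forall fun v => (integrable_singKer_mul_shift hγ v).aestronglyMeasurable)
    (Eventually.of_forall fun v => ae_of_all _ fun u => ?_) ((integrable_singKer hγ).mul_const M)
    (ae_of_all _ fun u => ?_)
  · rw [norm_of_nonneg (mul_nonneg (singKer_nonneg _ _) (pow_three_mul_gaussM_nonneg _))]
    exact mul_le_mul_of_nonneg_left (hM _) (singKer_nonneg _ _)
  · simpa using (tendsto_pow_three_mul_gaussM.comp (tendsto_sub_const_normAtTop u)).const_mul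
      (singKer γ u)

lemma tendsto_normKer (γ : ℝ) (w : V3) :
    Tendsto (fun v => normKer γ v w) normAtTop (nhds 1) := by
  have h0 : Tendsto (fun v => ‖v - w‖ / jap v) normAtTop (nhds 1) := by
    rw [tendsto_iff_norm_sub_tendsto_zero]
    refine squeeze_zero (fun _ => norm_nonneg _) (fun v => ?_)
      (tendsto_jap.const_div_atTop (‖w‖ + 1))
    have := jap_pos v
    rw [div_sub_one this.ne', norm_div, norm_of_nonneg this.le, norm_eq_abs]
    gcongr
    rw [abs_le]
    constructor <;> linarith [norm_sub_norm_le v w, norm_sub_le v w, norm_le_jap v,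
      jap_le_norm_add_one v]
  have h1 := h0.rpow_const (p := γ) (Or.inl one_ne_zero)
  rw [one_rpow] at h1
  refine h1.congr fun v => ?_
  rw [normKer, div_rpow (norm_nonneg _) (jap_pos v).le, rpow_neg (jap_pos v).le,
    div_eq_inv_mul]

lemma integrable_normKer_mul {γ : ℝ} (hγ : γ ∈ Set.Ioo (-3 : ℝ) (-2)) (v : V3) {g : V3 → ℝ}
    (hg : Continuous g) {C : ℝ} (hC : ∀ w, |g w| ≤ C * (1 + ‖w‖ ^ 2)) :
    Integrable fun w => normKer γ v w * (g w * gaussM w) := by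
  have hC0 : 0 ≤ C := by
    have := (abs_nonneg _).trans (hC 0)
    simpa using this
  refine ((integrable_pow_three_mul_gaussM.add
    (integrable_singKer_sub_mul hγ.1 v)).const_mul (16 * C)).mono'
    ((measurable_normKer γ v).mul
      (hg.mul continuous_gaussM).measurable).aestronglyMeasurable (ae_of_all _ fun w => ?_)
  have hK : normKer γ v w ≤ 16 * (1 + ‖w‖ ^ 2) ^ 2 * (1 + singKer γ (v - w)) := by
    have := singKer_nonneg γ (v - w)
    rcases lt_or_ge ‖v - w‖ 1 with h | h
    · refine (normKer_le_of_lt_one hγ h).trans ?_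
      rw [mul_comm]
      gcongr
      linarith
    · refine (normKer_le_of_one_le hγ h).trans (le_mul_of_one_le_right (by positivity) ?_)
      linarith
  rw [norm_mul, norm_mul, norm_of_nonneg (gaussM_nonneg w), norm_of_nonneg (normKer_nonneg _ _ _),
    norm_eq_abs]
  have := gaussM_nonneg w
  have := singKer_nonneg γ (v - w)
  calc normKer γ v w * (|g w| * gaussM w)
      ≤ 16 * (1 + ‖w‖ ^ 2) ^ 2 * (1 + singKer γ (v - w)) * (C * (1 + ‖w‖ ^ 2) * gaussM w) := by
        gcongr
        exact hC w
    _ = _ := by simp only [Pi.add_apply]; ring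

lemma integrable_normKer_sub_one_mul {γ : ℝ} (hγ : γ ∈ Set.Ioo (-3 : ℝ) (-2)) (v : V3) :
    Integrable fun w => |normKer γ v w - 1| * ((1 + ‖w‖ ^ 2) * gaussM w) := by
  have hb (w : V3) : |1 + ‖w‖ ^ 2| ≤ 1 * (1 + ‖w‖ ^ 2) := by
    rw [abs_of_nonneg (by positivity), one_mul]
  have h := ((integrable_normKer_mul hγ v (by fun_prop) hb).sub
    (integrable_mul_gaussM (by fun_prop) hb)).norm
  refine h.congr (ae_of_all _ fun w => ?_)
  have := gaussM_nonneg w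
  simp only [Pi.sub_apply]
  rw [← sub_one_mul, norm_mul, norm_of_nonneg (r := _ * gaussM w) (by positivity), norm_eq_abs]

lemma tendsto_integral_normKer_sub_one {γ : ℝ} (hγ : γ ∈ Set.Ioo (-3 : ℝ) (-2)) :
    Tendsto (fun v => ∫ w, |normKer γ v w - 1| * ((1 + ‖w‖ ^ 2) * gaussM w))
      normAtTop (nhds 0) := by
  let A (v w : V3) : ℝ :=
    (if ‖v - w‖ < 1 then 1 else |normKer γ v w - 1|) * ((1 + ‖w‖ ^ 2) * gaussM w)
  have hg : Measurable gaussM := continuous_gaussM.measurable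
  have hAmeas (v : V3) : AEStronglyMeasurable (A v) := by
    have := measurable_normKer γ v
    refine Measurable.aestronglyMeasurable (Measurable.mul (Measurable.ite
      (measurableSet_lt (by fun_prop) measurable_const) measurable_const ?_) (by fun_prop))
    exact (this.sub_const 1).norm
  have hAle (v w : V3) : ‖A v w‖ ≤ 17 * ((1 + ‖w‖ ^ 2) ^ 3 * gaussM w) := by
    have := gaussM_nonneg w
    have h1 : 1 ≤ (1 + ‖w‖ ^ 2) ^ 2 := one_le_pow₀ (by nlinarith [sq_nonneg ‖w‖])
    have h2 : |(if ‖v - w‖ < 1 then 1 else |normKer γ v w - 1| : ℝ)| ≤ 17 * (1 + ‖w‖ ^ 2) ^ 2 := by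
      split_ifs with h
      · rw [abs_one]; linarith
      · rw [abs_abs, abs_le]
        have := normKer_le_of_one_le hγ (not_lt.1 h)
        have := normKer_nonneg γ v w
        constructor <;> linarith
    simp only [A]
    rw [norm_mul, norm_of_nonneg (r := _ * gaussM w) (by positivity), norm_eq_abs]
    calc _ ≤ 17 * (1 + ‖w‖ ^ 2) ^ 2 * ((1 + ‖w‖ ^ 2) * gaussM w) := by gcongr
      _ = _ := by ring
  have hA : Tendsto (fun v => ∫ w, A v w) normAtTop (nhds 0) := by
    rw [← integral_zero V3 ℝ]
    refine tendsto_integral_filter_of_dominated_convergence _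
      (Eventually.of_forall hAmeas) (Eventually.of_forall fun v => ae_of_all _ (hAle v))
      (integrable_pow_three_mul_gaussM.const_mul 17) (ae_of_all _ fun w => ?_)
    have h1 := ((tendsto_normKer γ w).sub_const 1).abs.mul_const ((1 + ‖w‖ ^ 2) * gaussM w)
    rw [sub_self, abs_zero, zero_mul] at h1
    refine h1.congr' ?_
    have h2 : Tendsto (fun v : V3 => ‖v - w‖) normAtTop atTop :=
      Tendsto.comp tendsto_comap (tendsto_sub_const_normAtTop w)
    filter_upwards [h2.eventually_ge_atTop 1] with v hv
    simp [A, not_lt.2 hv]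
  have hB := (tendsto_integral_singKer hγ.1).const_mul 16
  have hAB := hA.add hB
  rw [mul_zero, add_zero] at hAB
  have hAint (v : V3) : Integrable (A v) :=
    (integrable_pow_three_mul_gaussM.const_mul 17).mono' (hAmeas v) (ae_of_all _ (hAle v))
  refine squeeze_zero (fun v => integral_nonneg fun w => ?_) (fun v => ?_) hAB
  · have := gaussM_nonneg w
    positivity
  · rw [← integral_const_mul,
      ← integral_add (hAint v) ((integrable_singKer_sub_mul hγ.1 v).const_mul 16)]
    refine integral_mono (integrable_normKer_sub_one_mul hγ v)
      ((hAint v).add ((integrable_singKer_sub_mul hγ.1 v).const_mul 16)) fun w => ?_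
    have := gaussM_nonneg w
    have hs := singKer_nonneg γ (v - w)
    simp only [A]
    split_ifs with h
    · have h1 : |normKer γ v w - 1| ≤ 1 + singKer γ (v - w) * (16 * (1 + ‖w‖ ^ 2) ^ 2) := by
        have := normKer_le_of_lt_one hγ h
        have := normKer_nonneg γ v w
        rw [abs_le]
        constructor <;> linarith
      calc _ ≤ (1 + singKer γ (v - w) * (16 * (1 + ‖w‖ ^ 2) ^ 2)) *
            ((1 + ‖w‖ ^ 2) * gaussM w) := by gcongr
        _ = _ := by ring
    · have : 0 ≤ 16 * (singKer γ (v - w) * ((1 + ‖w‖ ^ 2) ^ 3 * gaussM w)) := by positivity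
      linarith

/-- Integrating against the kernel `⟨v⟩^{-γ} |v - w|^γ` does not change the limit. -/
lemma tendsto_integral_normKer_mul {γ : ℝ} (hγ : γ ∈ Set.Ioo (-3 : ℝ) (-2)) {G : V3 → V3 → ℝ}
    (hG : ∀ v, Continuous (G v)) {C L : ℝ} (hC : ∀ v w, |G v w| ≤ C * (1 + ‖w‖ ^ 2))
    (hL : Tendsto (fun v => ∫ w, G v w * gaussM w) normAtTop (nhds L)) :
    Tendsto (fun v => ∫ w, normKer γ v w * (G v w * gaussM w)) normAtTop (nhds L) := by
  have h0 : Tendsto (fun v => (∫ w, normKer γ v w * (G v w * gaussM w)) -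
      ∫ w, G v w * gaussM w) normAtTop (nhds 0) := by
    have hb := (tendsto_integral_normKer_sub_one hγ).const_mul C
    rw [mul_zero] at hb
    refine squeeze_zero_norm (fun v => ?_) hb
    rw [← integral_sub (integrable_normKer_mul hγ v (hG v) (hC v))
      (integrable_mul_gaussM (hG v) (hC v)), ← integral_const_mul]
    refine norm_integral_le_of_norm_le ((integrable_normKer_sub_one_mul hγ v).const_mul C)
      (ae_of_all _ fun w => ?_)
    have := gaussM_nonneg w
    rw [← sub_one_mul, norm_mul, norm_mul, norm_of_nonneg this, norm_eq_abs, norm_eq_abs]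
    calc _ ≤ |normKer γ v w - 1| * (C * (1 + ‖w‖ ^ 2) * gaussM w) := by
          gcongr; exact hC v w
      _ = _ := by ring
  simpa using h0.add hL

lemma hasFDerivAt_gaussWeight (κ : ℝ) (v : V3) :
    HasFDerivAt (fun w : V3 => exp (κ * jap w ^ 2))
      ((exp (κ * jap v ^ 2)) • κ • (2 • innerSL ℝ v)) v := by
  simp_rw [jap_sq]
  exact (((hasStrictFDerivAt_norm_sq v).hasFDerivAt.const_add 1).const_mul κ).exp

lemma pd_gaussWeight (κ : ℝ) (i : Fin 3) (v : V3) :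
    pd i (fun w => exp (κ * jap w ^ 2)) v = 2 * κ * v i * exp (κ * jap v ^ 2) := by
  rw [pd, (hasFDerivAt_gaussWeight κ v).fderiv]
  simp [EuclideanSpace.inner_single_right]
  ring

lemma pd_pd_gaussWeight (κ : ℝ) (i j : Fin 3) (v : V3) :
    pd i (pd j (fun w => exp (κ * jap w ^ 2))) v =
      (4 * κ ^ 2 * (v i * v j) + 2 * κ * if i = j then 1 else 0) * exp (κ * jap v ^ 2) := by
  rw [funext (pd_gaussWeight κ j), pd]
  have h : HasFDerivAt (fun w : V3 => 2 * κ * w j)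
      ((2 * κ) • (EuclideanSpace.proj j : V3 →L[ℝ] ℝ)) v :=
    (EuclideanSpace.proj j : V3 →L[ℝ] ℝ).hasFDerivAt.const_mul (2 * κ)
  rw [(h.fun_mul (hasFDerivAt_gaussWeight κ v)).fderiv]
  simp [EuclideanSpace.inner_single_right, eq_comm (a := j)]
  split_ifs <;> ring

lemma aker_eq {γ : ℝ} (hγ : γ ∈ Set.Ioo (-3 : ℝ) (-2)) (z : V3) (i j : Fin 3) :
    aker γ z i j = ‖z‖ ^ γ * ((if i = j then 1 else 0) * ‖z‖ ^ 2 - z i * z j) := by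
  rcases eq_or_ne z 0 with rfl | hz
  · have h1 : γ + 2 ≠ 0 := by linarith [hγ.2]
    simp [aker, zero_rpow h1]
  · have hz' : 0 < ‖z‖ := norm_pos_iff.2 hz
    rw [aker, rpow_add hz', rpow_two]
    field_simp

lemma abs_coord_sub_mul_le (v w : V3) (i j : Fin 3) :
    |(v - w) i * (v - w) j| ≤ 2 * (1 + ‖v‖ ^ 2) * (1 + ‖w‖ ^ 2) := by
  rw [abs_mul]
  have := mul_le_mul (abs_coord_le (v - w) i) (abs_coord_le (v - w) j) (abs_nonneg _)
    (norm_nonneg _)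
  have h : ‖v - w‖ * ‖v - w‖ ≤ (‖v‖ + ‖w‖) * (‖v‖ + ‖w‖) := by
    gcongr <;> exact norm_sub_le v w
  nlinarith [sq_nonneg (‖v‖ - ‖w‖), sq_nonneg (‖v‖ * ‖w‖)]

/-- Linear combinations of the Landau coefficients, as one integral against `normKer`. -/
lemma jap_rpow_mul_coefficients {γ : ℝ} (hγ : γ ∈ Set.Ioo (-3 : ℝ) (-2)) (v : V3)
    (c : Fin 3 → Fin 3 → ℝ) (d : Fin 3 → ℝ) (e : ℝ) :
    jap v ^ (-γ) * ((∑ i, ∑ j, c i j * abar γ v i j) + (∑ i, d i * bbar γ v i) + e * Jfun γ v) =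
      ∫ w, normKer γ v w * (((∑ i, ∑ j, c i j *
        ((if i = j then 1 else 0) * ‖v - w‖ ^ 2 - (v - w) i * (v - w) j)) +
        (∑ i, d i * (-2 * (v - w) i)) + e) * gaussM w) := by
  set α : Fin 3 → Fin 3 → V3 → ℝ := fun i j w =>
    normKer γ v w * (((if i = j then 1 else 0) * ‖v - w‖ ^ 2 - (v - w) i * (v - w) j) * gaussM w)
    with hα
  set β : Fin 3 → V3 → ℝ := fun i w => normKer γ v w * (-2 * (v - w) i * gaussM w) with hβ
  set δ : V3 → ℝ := fun w => normKer γ v w * (1 * gaussM w) with hδ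
  have hsq (w : V3) : ‖v - w‖ ^ 2 ≤ 2 * (1 + ‖v‖ ^ 2) * (1 + ‖w‖ ^ 2) := by
    have h : ‖v - w‖ ^ 2 ≤ (‖v‖ + ‖w‖) ^ 2 := by gcongr; exact norm_sub_le v w
    nlinarith [sq_nonneg (‖v‖ - ‖w‖), sq_nonneg (‖v‖ * ‖w‖)]
  have iα (i j : Fin 3) : Integrable (α i j) := by
    refine integrable_normKer_mul hγ v (by fun_prop) (C := 4 * (1 + ‖v‖ ^ 2)) fun w => ?_
    refine (abs_sub _ _).trans ?_
    have h1 : |(if i = j then (1 : ℝ) else 0) * ‖v - w‖ ^ 2| ≤ ‖v - w‖ ^ 2 := by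
      split_ifs <;> simp
    linarith [abs_coord_sub_mul_le v w i j, hsq w]
  have iβ (i : Fin 3) : Integrable (β i) := by
    refine integrable_normKer_mul hγ v (by fun_prop) (C := 4 * (1 + ‖v‖ ^ 2)) fun w => ?_
    rw [abs_mul, abs_neg, abs_two]
    have := (abs_coord_le (v - w) i).trans (norm_sub_le v w)
    nlinarith [sq_nonneg (‖v‖ - 1), sq_nonneg (‖w‖ - 1), sq_nonneg (‖v‖ * ‖w‖)]
  have iδ : Integrable δ :=
    integrable_normKer_mul hγ v continuous_const (C := 1) fun w => by
      rw [abs_one]; nlinarith [sq_nonneg ‖w‖]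
  have ea (i j : Fin 3) : jap v ^ (-γ) * abar γ v i j = ∫ w, α i j w := by
    rw [abar, ← integral_const_mul]
    congr 1 with w
    rw [aker_eq hγ, hα]
    simp only [normKer]
    ring
  have eb (i : Fin 3) : jap v ^ (-γ) * bbar γ v i = ∫ w, β i w := by
    rw [bbar, ← integral_const_mul]
    congr 1 with w
    simp only [hβ, normKer, bker]
    ring
  have ej : jap v ^ (-γ) * Jfun γ v = ∫ w, δ w := by
    rw [Jfun, ← integral_const_mul]
    congr 1 with w
    simp only [hδ, normKer]
    ring
  have sα (i : Fin 3) : Integrable fun w => ∑ j, c i j * α i j w :=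
    integrable_finsetSum _ fun j _ => (iα i j).const_mul _
  have sβ : Integrable fun w => ∑ i, d i * β i w :=
    integrable_finsetSum _ fun i _ => (iβ i).const_mul _
  have sα' : Integrable fun w => ∑ i, ∑ j, c i j * α i j w :=
    integrable_finsetSum _ fun i _ => sα i
  have sαβ : Integrable fun w => (∑ i, ∑ j, c i j * α i j w) + ∑ i, d i * β i w := sα'.add sβ
  calc _ = (∑ i, ∑ j, c i j * (jap v ^ (-γ) * abar γ v i j)) +
        (∑ i, d i * (jap v ^ (-γ) * bbar γ v i)) + e * (jap v ^ (-γ) * Jfun γ v) := by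
        simp only [mul_add, Finset.mul_sum, mul_left_comm (jap v ^ (-γ))]
    _ = ∫ w, ((∑ i, ∑ j, c i j * α i j w) + ∑ i, d i * β i w) + e * δ w := by
        rw [integral_add sαβ (iδ.const_mul e), integral_add sα' sβ,
          integral_finsetSum _ fun i _ => sα i,
          integral_finsetSum _ fun i _ => (iβ i).const_mul _]
        simp_rw [integral_finsetSum _ fun j _ => (iα _ j).const_mul _, integral_const_mul,
          ea, eb, ej]
    _ = _ := by
        congr 1 with w
        simp only [hα, hβ, hδ, Fin.sum_univ_three]
        ring

/-- The quadratic polynomial in `w` obtained by contracting the kernels with `v`. -/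
def quadForm (p q s e : ℝ) (v w : V3) : ℝ :=
  p * (‖v‖ ^ 2 * ‖w‖ ^ 2 - inner ℝ v w ^ 2) + 2 * q * ‖v - w‖ ^ 2
    - 2 * s * (‖v‖ ^ 2 - inner ℝ v w) + e

lemma quadForm_eq_contraction (p q s e : ℝ) (v w : V3) :
    (∑ i, ∑ j, (p * (v i * v j) + q * if i = j then 1 else 0) *
        ((if i = j then 1 else 0) * ‖v - w‖ ^ 2 - (v - w) i * (v - w) j)) +
      (∑ i, s * v i * (-2 * (v - w) i)) + e = quadForm p q s e v w := by
  simp [quadForm, EuclideanSpace.real_norm_sq_eq, PiLp.inner_apply, Fin.sum_univ_three]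
  ring

lemma quadForm_eq_sum (p q s e : ℝ) (v w : V3) :
    quadForm p q s e v w = (2 * q * ‖v‖ ^ 2 - 2 * s * ‖v‖ ^ 2 + e) +
      ∑ i, (2 * s - 4 * q) * v i * w i +
      ∑ i, ∑ j, (p * ((if i = j then 1 else 0) * ‖v‖ ^ 2 - v i * v j) +
        2 * q * if i = j then 1 else 0) * (w i * w j) := by
  simp [quadForm, EuclideanSpace.real_norm_sq_eq, PiLp.inner_apply, Fin.sum_univ_three]
  ring

lemma integral_quadForm_mul_gaussM (p q s e : ℝ) (v : V3) :
    ∫ w, quadForm p q s e v w * gaussM w =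
      (2 * p + 2 * q - 2 * s) * ‖v‖ ^ 2 + (6 * q + e) := by
  simp_rw [quadForm_eq_sum]
  rw [integral_quadratic_mul_gaussM]
  simp [EuclideanSpace.real_norm_sq_eq, Fin.sum_univ_three]
  ring

lemma abs_quadForm_le (p q s e : ℝ) (v w : V3) :
    |quadForm p q s e v w| ≤
      (|p| + 4 * |q| + 4 * |s| + |e|) * ((1 + ‖v‖ ^ 2) * (1 + ‖w‖ ^ 2)) := by
  have hi := abs_real_inner_le_norm v w
  have hi2 : inner ℝ v w ^ 2 ≤ ‖v‖ ^ 2 * ‖w‖ ^ 2 := by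
    rw [← mul_pow, ← sq_abs]; gcongr
  have hn : ‖v - w‖ ^ 2 ≤ (‖v‖ + ‖w‖) ^ 2 := by gcongr; exact norm_sub_le v w
  set X := (1 + ‖v‖ ^ 2) * (1 + ‖w‖ ^ 2) with hX
  have hp : |‖v‖ ^ 2 * ‖w‖ ^ 2 - inner ℝ v w ^ 2| ≤ X := by
    rw [abs_of_nonneg (by linarith)]
    nlinarith [sq_nonneg (inner ℝ v w), sq_nonneg ‖v‖, sq_nonneg ‖w‖]
  have hq : |‖v - w‖ ^ 2| ≤ 2 * X := by
    rw [abs_of_nonneg (by positivity)]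
    nlinarith [sq_nonneg (‖v‖ - ‖w‖), sq_nonneg (‖v‖ * ‖w‖)]
  have hs : |‖v‖ ^ 2 - inner ℝ v w| ≤ 2 * X := by
    refine (abs_sub _ _).trans ?_
    rw [abs_of_nonneg (by positivity)]
    nlinarith [sq_nonneg (‖v‖ - ‖w‖), sq_nonneg (‖v‖ * ‖w‖), sq_nonneg ‖v‖, sq_nonneg ‖w‖]
  have he : 1 ≤ X := by nlinarith [sq_nonneg (‖v‖ * ‖w‖), sq_nonneg ‖v‖, sq_nonneg ‖w‖]
  rw [quadForm]
  refine (abs_add_le _ _).trans ?_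
  have h1 := (abs_sub (p * (‖v‖ ^ 2 * ‖w‖ ^ 2 - inner ℝ v w ^ 2) + 2 * q * ‖v - w‖ ^ 2)
    (2 * s * (‖v‖ ^ 2 - inner ℝ v w)))
  have h2 := abs_add_le (p * (‖v‖ ^ 2 * ‖w‖ ^ 2 - inner ℝ v w ^ 2)) (2 * q * ‖v - w‖ ^ 2)
  simp only [abs_mul, abs_two] at h1 h2
  have := mul_le_mul_of_nonneg_left hp (abs_nonneg p)
  have := mul_le_mul_of_nonneg_left hq (abs_nonneg q)
  have := mul_le_mul_of_nonneg_left hs (abs_nonneg s)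
  have := mul_le_mul_of_nonneg_left he (abs_nonneg e)
  linarith

lemma tendsto_contraction {γ : ℝ} (hγ : γ ∈ Set.Ioo (-3 : ℝ) (-2)) (p q s e : ℝ) :
    Tendsto (fun v => ((∑ i, ∑ j, (p * (v i * v j) + q * if i = j then 1 else 0) * abar γ v i j) +
        (∑ i, s * v i * bbar γ v i) + e * Jfun γ v) * jap v ^ (-2 - γ))
      normAtTop (nhds (2 * p + 2 * q - 2 * s)) := by
  have hL : Tendsto (fun v => ∫ w, quadForm p q s e v w / jap v ^ 2 * gaussM w) normAtTop
      (nhds (2 * p + 2 * q - 2 * s)) := by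
    have h := (((tendsto_pow_atTop two_ne_zero).comp tendsto_jap).const_div_atTop
      (6 * q + e - (2 * p + 2 * q - 2 * s))).const_add (2 * p + 2 * q - 2 * s)
    rw [add_zero] at h
    refine h.congr fun v => ?_
    have h0 : jap v ^ 2 ≠ 0 := (pow_pos (jap_pos v) 2).ne'
    simp_rw [div_mul_eq_mul_div]
    rw [integral_div, integral_quadForm_mul_gaussM, eq_div_iff h0, Function.comp_apply, add_mul,
      div_mul_cancel₀ _ h0, jap_sq]
    ring
  have hcont (v : V3) : Continuous fun w => quadForm p q s e v w / jap v ^ 2 := by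
    unfold quadForm; fun_prop
  refine (tendsto_integral_normKer_mul hγ hcont (C := |p| + 4 * |q| + 4 * |s| + |e|)
    (fun v w => ?_) hL).congr fun v => ?_
  · rw [abs_div, abs_of_pos (pow_pos (jap_pos v) 2), div_le_iff₀ (pow_pos (jap_pos v) 2), jap_sq]
    linarith [abs_quadForm_le p q s e v w]
  · have h := jap_rpow_mul_coefficients hγ v
      (fun i j => p * (v i * v j) + q * if i = j then 1 else 0) (fun i => s * v i) e
    simp only [quadForm_eq_contraction] at h
    rw [show -2 - γ = -γ - (2 : ℕ) by push_cast; ring, rpow_sub_natCast (jap_pos v).ne',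
      mul_comm, div_mul_eq_mul_div, h, ← integral_div]
    congr 1 with w
    ring

lemma zeta_gaussWeight (γ κ : ℝ) (v : V3) :
    zeta γ (fun w => exp (κ * jap w ^ 2)) v =
      (∑ i, ∑ j, (8 * κ ^ 2 * (v i * v j) + 2 * κ * if i = j then 1 else 0) * abar γ v i j) +
        (∑ i, 4 * κ * v i * bbar γ v i) + (γ + 3) * Jfun γ v := by
  have h := (exp_pos (κ * jap v ^ 2)).ne'
  simp only [zeta, cbar, pd_gaussWeight, pd_pd_gaussWeight, mul_div_assoc, div_self h, mul_one,
    Fin.sum_univ_three]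
  ring

lemma zetaT_gaussWeight (γ κ : ℝ) (v : V3) :
    zetaT γ (fun w => exp (κ * jap w ^ 2)) v =
      (∑ i, ∑ j, (4 * κ ^ 2 * (v i * v j) + 0 * if i = j then 1 else 0) * abar γ v i j) +
        (∑ i, 2 * κ * v i * bbar γ v i) + (γ + 3) * Jfun γ v := by
  have h := (exp_pos (κ * jap v ^ 2)).ne'
  simp only [zetaT, cbar, pd_gaussWeight, mul_div_assoc, div_self h, mul_one,
    Fin.sum_univ_three]
  ring

/-- Lemma 2.2 (3): for the Gaussian weight m = exp(κ⟨v⟩²), κ ∈ (0,1/2),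
limsup_{|v|→∞} ζ_m(v)⟨v⟩^{−2−γ} ≤ 4κ(4κ−1) and limsup ζ̃_m(v)⟨v⟩^{−2−γ} ≤ 4κ(2κ−1). -/
theorem stmt9 (γ κ : ℝ) (hγ : γ ∈ Set.Ioo (-3 : ℝ) (-2)) (hκ : κ ∈ Set.Ioo (0 : ℝ) (1 / 2)) :
    Filter.limsup
      (fun v : V3 => zeta γ (fun w => Real.exp (κ * jap w ^ 2)) v * jap v ^ (-2 - γ))
      normAtTop ≤ 4 * κ * (4 * κ - 1) ∧
    Filter.limsup
      (fun v : V3 => zetaT γ (fun w => Real.exp (κ * jap w ^ 2)) v * jap v ^ (-2 - γ))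
      normAtTop ≤ 4 * κ * (2 * κ - 1) := by
  simp_rw [zeta_gaussWeight, zetaT_gaussWeight]
  rw [(tendsto_contraction hγ _ _ _ _).limsup_eq, (tendsto_contraction hγ _ _ _ _).limsup_eq]
  constructor <;> linarith
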